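/- Let φ be a W-linear endomorphism of N with matrix A = (a_{ij}) commuting with F. Let α, β ∈ k with α^{p²} = α and β^{p²} = β, and let b ∈ k with b^{p²} ≠ b and b² = α·b + β. Then φ(M_b) ⊆ M_b if and only if ρ(a₁₁) − ρ(a₃₃) + ρ(a₁₃)·α = 0 and ρ(a₁₃)·β = ρ(a₃₁). -/

import Mathlib

/-!
Common setup: `p` a prime, `k` an algebraically closed field of characteristic `p`,
`W = W(k)` the ring of `p`-typical Witt vectors, `σ` the Witt vector Frobenius,
`ρ : W → k` reduction (0-th coefficient), `N = W⁴` with the semilinear maps `F`, `V`,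
the Gram matrix `J'` of the alternating form, the Dieudonné submodules `M_b`, and the
coordinate map `q` for `N/V(N)`.
-/

noncomputable section

open WittVector Matrix

variable (p : ℕ) [Fact p.Prime] (k : Type) [Field k] [IsAlgClosed k] [CharP k p]

/-- The reduction map `ρ : W(k) → k` sending a Witt vector to its 0-th coefficient. -/
def redW : WittVector p k →+* k where
  toFun x := x.coeff 0
  map_one' := WittVector.one_coeff_zero p k
  map_mul' := WittVector.mul_coeff_zero
  map_zero' := WittVector.zero_coeff p k 0
  map_add' := WittVector.add_coeff_zero

/-- The Witt vector Frobenius `σ`, a ring automorphism of `W(k)` since `k` is perfect. -/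
def sigmaW : WittVector p k ≃+* WittVector p k := WittVector.frobeniusEquiv p k

/-- The standard basis vectors `e₁, e₂, e₃, e₄` of `N = W⁴` (0-indexed). -/
def eW (i : Fin 4) : Fin 4 → WittVector p k := Pi.single i 1

/-- The `σ`-semilinear map `F : N → N` with `F e₁ = e₂`, `F e₂ = -p e₁`,
`F e₃ = e₄`, `F e₄ = -p e₃`. -/
def Fmap : (Fin 4 → WittVector p k) → (Fin 4 → WittVector p k) := fun x =>
  ![-(p : WittVector p k) * sigmaW p k (x 1), sigmaW p k (x 0),
    -(p : WittVector p k) * sigmaW p k (x 3), sigmaW p k (x 2)]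

/-- The `σ⁻¹`-semilinear map `V : N → N` with `V e₁ = -e₂`, `V e₂ = p e₁`,
`V e₃ = -e₄`, `V e₄ = p e₃`. -/
def Vmap : (Fin 4 → WittVector p k) → (Fin 4 → WittVector p k) := fun x =>
  ![(p : WittVector p k) * (sigmaW p k).symm (x 1), -(sigmaW p k).symm (x 0),
    (p : WittVector p k) * (sigmaW p k).symm (x 3), -(sigmaW p k).symm (x 2)]

/-- The Gram matrix `J'` of the alternating form `⟨ , ⟩` on `N` with
`⟨e₁,e₃⟩ = 1 = -⟨e₃,e₁⟩`, `⟨e₂,e₄⟩ = p = -⟨e₄,e₂⟩`. -/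
def Jmat : Matrix (Fin 4) (Fin 4) (WittVector p k) :=
  !![0, 0, 1, 0;
     0, 0, 0, (p : WittVector p k);
     -1, 0, 0, 0;
     0, -(p : WittVector p k), 0, 0]

/-- The `W`-linear endomorphism of `N` with matrix `A` commutes with `F`. -/
def CommF (A : Matrix (Fin 4) (Fin 4) (WittVector p k)) : Prop :=
  ∀ x, A.mulVec (Fmap p k x) = Fmap p k (A.mulVec x)

/-- The `W`-submodule `M_b` of `N` spanned by `p e₁, p e₃, e₂, e₄` and `e₁ + b̃ e₃`,
where `b̃` is the Teichmüller lift of `b` (a lift of `b` under `ρ`). -/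
def Mmod (b : k) : Submodule (WittVector p k) (Fin 4 → WittVector p k) :=
  Submodule.span (WittVector p k)
    {(p : WittVector p k) • eW p k 0, (p : WittVector p k) • eW p k 2, eW p k 1, eW p k 3,
     eW p k 0 + WittVector.teichmuller p b • eW p k 2}

/-- Coordinates of the class of `x ∈ N` in `N/V(N) ≃ k²` with respect to the basis given
by the classes of `e₁` and `e₃`. -/
def qmap : (Fin 4 → WittVector p k) → (Fin 2 → k) := fun x => ![redW p k (x 0), redW p k (x 2)]

section

variable {p k}

theorem redW_teichmuller {K : Type} [Field K] (b : K) :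
    redW p K (WittVector.teichmuller p b) = b :=
  WittVector.teichmuller_coeff_zero p b

theorem redW_sigmaW (x : WittVector p k) : redW p k (sigmaW p k x) = redW p k x ^ p :=
  WittVector.coeff_frobenius_charP p x 0

theorem exists_p_mul_of_redW_eq_zero {x : WittVector p k} (hx : redW p k x = 0) :
    ∃ y, x = (p : WittVector p k) * y :=
  Ideal.mem_span_singleton.mp ((WittVector.mem_span_p_iff_coeff_zero_eq_zero x).mpr hx)

theorem mem_Mmod_iff (b : k) (x : Fin 4 → WittVector p k) :
    x ∈ Mmod p k b ↔ redW p k (x 2) = b * redW p k (x 0) := by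
  constructor
  · intro hx
    induction hx using Submodule.span_induction with
    | mem y hy =>
      simp only [Set.mem_insert_iff, Set.mem_singleton_iff] at hy
      rcases hy with rfl | rfl | rfl | rfl | rfl <;>
        simp [eW, redW_teichmuller]
    | zero => simp
    | add y z _ _ hy hz => simp only [Pi.add_apply, map_add, hy, hz]; ring
    | smul a y _ hy => simp only [Pi.smul_apply, smul_eq_mul, map_mul, hy]; ring
  · intro hx
    obtain ⟨y, hy⟩ := exists_p_mul_of_redW_eq_zero
      (x := x 2 - x 0 * WittVector.teichmuller p b)
      (by rw [map_sub, map_mul, redW_teichmuller, hx]; ring)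
    have hdecomp : x = y • ((p : WittVector p k) • eW p k 2) + x 1 • eW p k 1 +
        x 3 • eW p k 3 + x 0 • (eW p k 0 + WittVector.teichmuller p b • eW p k 2) := by
      funext i
      fin_cases i <;> simp [eW]
      linear_combination hy
    rw [hdecomp]
    refine add_mem (add_mem (add_mem ?_ ?_) ?_) ?_ <;>
      exact Submodule.smul_mem _ _ (Submodule.subset_span (by simp))

theorem redW_pow_p_sq_of_p_mul_eq {x : WittVector p k}
    (h : (p : WittVector p k) * x = p * sigmaW p k (sigmaW p k x)) :
    redW p k x ^ p ^ 2 = redW p k x := by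
  have hx := mul_left_cancel₀ (WittVector.p_nonzero p k) h
  conv_rhs => rw [hx]
  rw [redW_sigmaW, redW_sigmaW, ← pow_mul, sq]

theorem CommF.col_zero {A : Matrix (Fin 4) (Fin 4) (WittVector p k)} (hF : CommF p k A) :
    redW p k (A 0 1) = 0 ∧ redW p k (A 2 1) = 0 ∧
      redW p k (A 0 0) ^ p ^ 2 = redW p k (A 0 0) ∧
      redW p k (A 2 0) ^ p ^ 2 = redW p k (A 2 0) := by
  have h₀ := hF (eW p k 0)
  have h₁ := hF (eW p k 1)
  have h₀₀ := congrFun h₀ 0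
  have h₀₁ := congrFun h₀ 1
  have h₀₂ := congrFun h₀ 2
  have h₀₃ := congrFun h₀ 3
  have h₁₀ := congrFun h₁ 0
  have h₁₂ := congrFun h₁ 2
  simp [Fmap, eW, Matrix.mulVec, dotProduct, Fin.sum_univ_four] at h₀₀ h₀₁ h₀₂ h₀₃ h₁₀ h₁₂
  refine ⟨?_, ?_, redW_pow_p_sq_of_p_mul_eq ?_, redW_pow_p_sq_of_p_mul_eq ?_⟩
  · rw [h₀₀]; simp
  · rw [h₀₂]; simp
  · rw [← h₀₁]; linear_combination h₁₀
  · rw [← h₀₃]; linear_combination h₁₂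

theorem CommF.col_two {A : Matrix (Fin 4) (Fin 4) (WittVector p k)} (hF : CommF p k A) :
    redW p k (A 0 3) = 0 ∧ redW p k (A 2 3) = 0 ∧
      redW p k (A 0 2) ^ p ^ 2 = redW p k (A 0 2) ∧
      redW p k (A 2 2) ^ p ^ 2 = redW p k (A 2 2) := by
  have h₂ := hF (eW p k 2)
  have h₃ := hF (eW p k 3)
  have h₂₀ := congrFun h₂ 0
  have h₂₁ := congrFun h₂ 1
  have h₂₂ := congrFun h₂ 2
  have h₂₃ := congrFun h₂ 3
  have h₃₀ := congrFun h₃ 0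
  have h₃₂ := congrFun h₃ 2
  simp [Fmap, eW, Matrix.mulVec, dotProduct, Fin.sum_univ_four] at h₂₀ h₂₁ h₂₂ h₂₃ h₃₀ h₃₂
  refine ⟨?_, ?_, redW_pow_p_sq_of_p_mul_eq ?_, redW_pow_p_sq_of_p_mul_eq ?_⟩
  · rw [h₂₀]; simp
  · rw [h₂₂]; simp
  · rw [← h₂₁]; linear_combination h₃₀
  · rw [← h₂₃]; linear_combination h₃₂

theorem CommF.mapsTo_Mmod_iff {A : Matrix (Fin 4) (Fin 4) (WittVector p k)}
    (hF : CommF p k A) (b : k) :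
    (∀ x ∈ Mmod p k b, A.mulVec x ∈ Mmod p k b) ↔
      redW p k (A 2 0) + redW p k (A 2 2) * b =
        b * (redW p k (A 0 0) + redW p k (A 0 2) * b) := by
  obtain ⟨h01, h21, -⟩ := hF.col_zero
  obtain ⟨h03, h23, -⟩ := hF.col_two
  have hmul (x : Fin 4 → WittVector p k) : A.mulVec x ∈ Mmod p k b ↔
      redW p k (A 2 0) * redW p k (x 0) + redW p k (A 2 2) * redW p k (x 2) =
        b * (redW p k (A 0 0) * redW p k (x 0) + redW p k (A 0 2) * redW p k (x 2)) := by
    simp [mem_Mmod_iff, Matrix.mulVec, dotProduct, Fin.sum_univ_four, h01, h21, h03, h23]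
  simp only [hmul, mem_Mmod_iff]
  constructor
  · intro h
    simpa [redW_teichmuller] using h ![1, 0, WittVector.teichmuller p b, 0]
      (by simp [redW_teichmuller])
  · intro h x hx
    rw [hx]
    linear_combination redW p k (x 0) * h

theorem eq_zero_and_eq_zero_of_mul_add_eq_zero {K : Type*} [Field K] [CharP K p]
    {b c d : K} (hb : b ^ p ^ 2 ≠ b) (hc : c ^ p ^ 2 = c) (hd : d ^ p ^ 2 = d)
    (h : c * b + d = 0) : c = 0 ∧ d = 0 := by
  have h' : c * b ^ p ^ 2 + d = 0 := by
    have := congrArg (· ^ p ^ 2) h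
    simpa [add_pow_char_pow, mul_pow, hc, hd, (Fact.out : p.Prime).ne_zero] using this
  have hc0 : c = 0 :=
    (mul_eq_zero.mp (by linear_combination h' - h : c * (b ^ p ^ 2 - b) = 0)).resolve_right
      (sub_ne_zero.mpr hb)
  exact ⟨hc0, by simpa [hc0] using h⟩

end

/-- for `φ` commuting with `F` and `b` quadratic over `𝔽_{p²}` with
`b² = αb + β`, `φ(M_b) ⊆ M_b` iff `ρ(a₁₁) - ρ(a₃₃) + ρ(a₁₃)·α = 0` and
`ρ(a₁₃)·β = ρ(a₃₁)`. -/
theorem mapsTo_Mb_iff_quadratic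
    (A : Matrix (Fin 4) (Fin 4) (WittVector p k)) (hF : CommF p k A)
    (α β : k) (hα : α ^ p ^ 2 = α) (hβ : β ^ p ^ 2 = β)
    (b : k) (hb : b ^ p ^ 2 ≠ b) (hquad : b ^ 2 = α * b + β) :
    (∀ x ∈ Mmod p k b, A.mulVec x ∈ Mmod p k b) ↔
      (redW p k (A 0 0) - redW p k (A 2 2) + redW p k (A 0 2) * α = 0 ∧
        redW p k (A 0 2) * β = redW p k (A 2 0)) := by
  obtain ⟨-, -, h00, h20⟩ := hF.col_zero
  obtain ⟨-, -, h02, h22⟩ := hF.col_two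
  rw [hF.mapsTo_Mmod_iff b]
  constructor
  · intro h
    have hzero := eq_zero_and_eq_zero_of_mul_add_eq_zero (p := p) hb
      (c := redW p k (A 0 0) - redW p k (A 2 2) + redW p k (A 0 2) * α)
      (d := redW p k (A 0 2) * β - redW p k (A 2 0))
      (by rw [add_pow_char_pow, sub_pow_char_pow, mul_pow, h00, h22, h02, hα])
      (by rw [sub_pow_char_pow, mul_pow, h20, h02, hβ])
      (by linear_combination -h - redW p k (A 0 2) * hquad)
    exact ⟨hzero.1, sub_eq_zero.mp hzero.2⟩
  · rintro ⟨h₁, h₂⟩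
    linear_combination -b * h₁ - h₂ - redW p k (A 0 2) * hquad

end
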